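/- Let 0 < α < 1, 0 < β₁, β₂ < 1 with 1 < β₁ + β₂, ν > 0, −∞ < a < b < +∞, T > 0, δ > 0, and let F : [a,b] × [0,T] → ℝ and ψ₁, ψ₂ : [0,T] → ℝ be continuous. Let u and ū be two continuous functions on [a,b] × [0,T] (each with t ↦ v(x,t) continuously differentiable on (0,T], x ↦ v(x,t) continuously differentiable on [a,b], the spatial sequential Caputo derivative 𝒟^{β₁}_{a+,x}𝒟^{β₂}_{a+,x} v continuous, and its Riemann–Liouville time derivative D^{1−α}_{0+,t} of it existing and continuous on [a,b] × (0,T]) that both satisfy ∂v/∂t(x,t) = ν · D^{1−α}_{0+,t}[𝒟^{β₁}_{a+,x}𝒟^{β₂}_{a+,x} v](x,t) + F(x,t) on (a,b) × (0,T] and v(a,t) = ψ₁(t), v(b,t) = ψ₂(t) for t ∈ [0,T], with initial data u(x,0) = φ(x) and ū(x,0) = φ̄(x) for continuous φ, φ̄. If max_{x∈[a,b]} |φ(x) − φ̄(x)| ≤ δ, then |u(x,t) − ū(x,t)| ≤ δ for all (x,t) ∈ [a,b] × [0,T]. -/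

import Mathlib

open Set

/-- The Caputo fractional derivative of order `γ` with base point `a`:
`(𝒟^γ_{a+} f)(t) = (1/Γ(1−γ)) ∫_a^t (t−s)^{−γ} f′(s) ds`. -/
noncomputable def caputo (γ a : ℝ) (f : ℝ → ℝ) (t : ℝ) : ℝ :=
  (1 / Real.Gamma (1 - γ)) * ∫ s in a..t, (t - s) ^ (-γ) * deriv f s

/-- The fractional integral appearing in the sequential Caputo derivative:
`t ↦ (1/Γ(1−α)) ∫_a^t (t−s)^{−α} (𝒟^β_{a+} f)(s) ds`. -/
noncomputable def seqCaputoAux (α β a : ℝ) (f : ℝ → ℝ) (t : ℝ) : ℝ :=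
  (1 / Real.Gamma (1 - α)) * ∫ s in a..t, (t - s) ^ (-α) * caputo β a f s

/-- The sequential Caputo derivative
`(𝒟^α_{a+}𝒟^β_{a+} f)(t) = (d/dt)[(1/Γ(1−α)) ∫_a^t (t−s)^{−α} (𝒟^β_{a+} f)(s) ds]`. -/
noncomputable def seqCaputo (α β a : ℝ) (f : ℝ → ℝ) : ℝ → ℝ :=
  deriv (seqCaputoAux α β a f)

/-- The fractional integral appearing in the Riemann–Liouville derivative with
base point `0`: `t ↦ (1/Γ(1−γ)) ∫_0^t (t−s)^{−γ} g(s) ds`. -/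
noncomputable def rlAux (γ : ℝ) (g : ℝ → ℝ) (t : ℝ) : ℝ :=
  (1 / Real.Gamma (1 - γ)) * ∫ s in (0:ℝ)..t, (t - s) ^ (-γ) * g s

/-- The Riemann–Liouville fractional derivative of order `γ` with base point `0`:
`(D^γ_{0+} g)(t) = (d/dt)[(1/Γ(1−γ)) ∫_0^t (t−s)^{−γ} g(s) ds]`. -/
noncomputable def rlDeriv (γ : ℝ) (g : ℝ → ℝ) : ℝ → ℝ :=
  deriv (rlAux γ g)

section FKHelpers

open MeasureTheory intervalIntegral

lemma fk_ker_int {p : ℝ} (hp : 0 < p) (x c d : ℝ) :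
    IntervalIntegrable (fun s => (x - s) ^ (p - 1)) volume c d := by
  have h := (intervalIntegral.intervalIntegrable_rpow' (r := p - 1) (by linarith)
    (a := x - c) (b := x - d)).comp_sub_left x
  simpa using h

lemma fk_ker_int' {p : ℝ} (hp : 0 < p) (x c d : ℝ) :
    IntervalIntegrable (fun s => (s - x) ^ (p - 1)) volume c d := by
  have h := (intervalIntegral.intervalIntegrable_rpow' (r := p - 1) (by linarith)
    (a := c - x) (b := d - x)).comp_sub_right x
  simpa using h

lemma fk_beta_int {p q : ℝ} (hp : 0 < p) (hq : 0 < q) {r t : ℝ} (hrt : r < t) :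
    IntervalIntegrable (fun s => (t - s) ^ (p - 1) * (s - r) ^ (q - 1)) volume r t := by
  have h1 : IntervalIntegrable (fun s => (t - s) ^ (p - 1) * (s - r) ^ (q - 1)) volume r
      ((r + t) / 2) := by
    apply IntervalIntegrable.continuousOn_mul (fk_ker_int' hq _ _ _)
    rw [uIcc_of_le (by linarith)]
    intro s hs
    have : t - s ≠ 0 := by have := hs.2; intro h; linarith
    exact ((continuousAt_const.sub continuousAt_id).rpow_const (Or.inl this)).continuousWithinAt
  have h2 : IntervalIntegrable (fun s => (t - s) ^ (p - 1) * (s - r) ^ (q - 1)) volume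
      ((r + t) / 2) t := by
    apply IntervalIntegrable.mul_continuousOn (fk_ker_int hp _ _ _)
    rw [uIcc_of_le (by linarith)]
    intro s hs
    have : s - r ≠ 0 := by have := hs.1; intro h; linarith
    exact ((continuousAt_id.sub continuousAt_const).rpow_const (Or.inl this)).continuousWithinAt
  exact h1.trans h2

/-- Beta constant. -/
noncomputable def fkB (p q : ℝ) : ℝ := ∫ x in (0:ℝ)..1, (1 - x) ^ (p - 1) * (x - 0) ^ (q - 1)

lemma fkB_pos {p q : ℝ} (hp : 0 < p) (hq : 0 < q) : 0 < fkB p q := by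
  apply intervalIntegral_pos_of_pos_on (fk_beta_int hp hq one_pos) _ one_pos
  intro x hx
  exact mul_pos (Real.rpow_pos_of_pos (by linarith [hx.2]) _)
    (Real.rpow_pos_of_pos (by linarith [hx.1]) _)

lemma fk_beta_scaled (p q : ℝ) {r t : ℝ} (hrt : r < t) :
    ∫ s in r..t, (t - s) ^ (p - 1) * (s - r) ^ (q - 1) = (t - r) ^ (p + q - 1) * fkB p q := by
  have hpos : 0 < t - r := by linarith
  have h := intervalIntegral.smul_integral_comp_mul_add (a := 0) (b := 1)
    (fun s => (t - s) ^ (p - 1) * (s - r) ^ (q - 1)) (t - r) r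
  have e : (t - r) * 1 + r = t := by ring
  rw [e, mul_zero, zero_add] at h
  rw [← h, fkB, smul_eq_mul, ← intervalIntegral.integral_const_mul,
    ← intervalIntegral.integral_const_mul]
  apply intervalIntegral.integral_congr
  intro x hx
  rw [uIcc_of_le zero_le_one] at hx
  have e1 : t - ((t - r) * x + r) = (t - r) * (1 - x) := by ring
  have e2 : ((t - r) * x + r) - r = (t - r) * (x - 0) := by ring
  simp only
  rw [e1, e2, Real.mul_rpow hpos.le (by linarith [hx.2]), Real.mul_rpow hpos.le (by linarith [hx.1]),
    show p + q - 1 = 1 + (p - 1) + (q - 1) by ring, Real.rpow_add hpos, Real.rpow_add hpos,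
    Real.rpow_one]
  ring

lemma fk_sg_aux {p q : ℝ} (hp : 0 < p) (hq : 0 < q) {a t : ℝ} (hat : a ≤ t) {g : ℝ → ℝ}
    (hg : Continuous g) :
    IntervalIntegrable (fun s => (t - s) ^ (p - 1) * ∫ r in a..s, (s - r) ^ (q - 1) * g r)
      volume a t ∧
    ∫ s in a..t, (t - s) ^ (p - 1) * (∫ r in a..s, (s - r) ^ (q - 1) * g r) =
      fkB p q * ∫ r in a..t, (t - r) ^ (p + q - 1) * g r := by
  set μ : Measure ℝ := volume.restrict (Ioc a t) with hμ
  set f : ℝ → ℝ → ℝ := fun s r =>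
    (Iio s).indicator (fun r => (t - s) ^ (p - 1) * (s - r) ^ (q - 1) * g r) r with hf
  have hmeas : Measurable (Function.uncurry f) := by
    have : Function.uncurry f = ({z : ℝ × ℝ | z.2 < z.1}).indicator
        (fun z => (t - z.1) ^ (p - 1) * (z.1 - z.2) ^ (q - 1) * g z.2) := by
      ext ⟨s, r⟩
      simp [f, indicator, Function.uncurry]
    rw [this]
    apply Measurable.indicator
    · have := hg.measurable
      fun_prop
    · exact measurableSet_lt measurable_snd measurable_fst
  -- inner integrals
  have hin1 : ∀ s ∈ Ioc a t, ∫ r, f s r ∂μ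
      = (t - s) ^ (p - 1) * ∫ r in a..s, (s - r) ^ (q - 1) * g r := by
    intro s hs
    rw [← intervalIntegral.integral_const_mul, intervalIntegral.integral_of_le hs.1.le, hμ,
      hf, MeasureTheory.integral_indicator measurableSet_Iio, Measure.restrict_restrict
      measurableSet_Iio, integral_Ioc_eq_integral_Ioo]
    have : Iio s ∩ Ioc a t = Ioo a s := by
      ext x; simp only [mem_inter_iff, mem_Iio, mem_Ioc, mem_Ioo]
      constructor
      · rintro ⟨h1, h2, h3⟩; exact ⟨h2, h1⟩
      · rintro ⟨h1, h2⟩; exact ⟨h2, h1, by linarith [hs.2]⟩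
    rw [this]
    apply MeasureTheory.integral_congr_ae
    filter_upwards with r
    ring
  have hset : ∀ r ∈ Ioc a t, Ioi r ∩ Ioc a t = Ioc r t := by
    intro r hr
    ext x; simp only [mem_inter_iff, mem_Ioi, mem_Ioc]
    constructor
    · rintro ⟨h1, h2, h3⟩; exact ⟨h1, h3⟩
    · rintro ⟨h1, h2⟩; exact ⟨h1, by linarith [hr.1], h2⟩
  have hfr : ∀ r, (fun s => f s r) = (Ioi r).indicator
      (fun s => (t - s) ^ (p - 1) * (s - r) ^ (q - 1) * g r) := by
    intro r; ext s; simp [f, indicator]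
  have hfrint : ∀ r ∈ Ioo a t, Integrable (fun s => f s r) μ := by
    intro r hr
    rw [hfr, integrable_indicator_iff measurableSet_Ioi, IntegrableOn, hμ,
      Measure.restrict_restrict measurableSet_Ioi, hset r ⟨hr.1, hr.2.le⟩]
    exact ((fk_beta_int hp hq hr.2).mul_const (g r)).1
  have hin2 : ∀ (h : ℝ → ℝ), ∀ r ∈ Ioo a t, ∫ s, (Ioi r).indicator
      (fun s => (t - s) ^ (p - 1) * (s - r) ^ (q - 1) * h r) s ∂μ
        = fkB p q * ((t - r) ^ (p + q - 1) * h r) := by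
    intro h r hr
    rw [MeasureTheory.integral_indicator measurableSet_Ioi, hμ,
      Measure.restrict_restrict measurableSet_Ioi, hset r ⟨hr.1, hr.2.le⟩,
      ← intervalIntegral.integral_of_le hr.2.le, intervalIntegral.integral_mul_const,
      fk_beta_scaled p q hr.2]
    ring
  have hnorm : ∀ r ∈ Ioo a t, ∫ s, ‖f s r‖ ∂μ = fkB p q * ((t - r) ^ (p + q - 1) * |g r|) := by
    intro r hr
    rw [← hin2 (fun r => |g r|) r hr]
    apply setIntegral_congr_fun measurableSet_Ioc
    intro s hs
    simp only [f, indicator, mem_Iio, mem_Ioi]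
    split_ifs with h
    · rw [norm_mul, Real.norm_eq_abs, Real.norm_eq_abs, abs_of_nonneg]
      exact mul_nonneg (Real.rpow_nonneg (by linarith [hs.2]) _)
        (Real.rpow_nonneg (by linarith) _)
    · simp
  have hae : ∀ᵐ r ∂μ, r ∈ Ioo a t := by
    rw [hμ, ← restrict_Ioo_eq_restrict_Ioc]
    exact ae_restrict_mem measurableSet_Ioo
  have hprod : Integrable (Function.uncurry f) (μ.prod μ) := by
    rw [integrable_prod_iff' hmeas.aestronglyMeasurable]
    constructor
    · filter_upwards [hae] with r hr using hfrint r hr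
    · have : IntervalIntegrable (fun r => fkB p q * ((t - r) ^ (p + q - 1) * |g r|)) volume a t :=
        ((fk_ker_int (by linarith) t a t).mul_continuousOn hg.abs.continuousOn).const_mul _
      have h2 := this.1
      refine Integrable.congr h2 ?_
      filter_upwards [hae] with r hr using (hnorm r hr).symm
  constructor
  · rw [intervalIntegrable_iff_integrableOn_Ioc_of_le hat]
    refine (hprod.integral_prod_left).congr ?_
    filter_upwards [ae_restrict_mem measurableSet_Ioc] with s hs
    exact hin1 s hs
  · have hsw := integral_integral_swap hprod
    rw [intervalIntegral.integral_of_le hat, intervalIntegral.integral_of_le hat,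
      ← MeasureTheory.integral_const_mul]
    have e1 : ∫ s, ∫ r, f s r ∂μ ∂μ = ∫ s in Ioc a t, (t - s) ^ (p - 1) *
        (∫ r in a..s, (s - r) ^ (q - 1) * g r) :=
      setIntegral_congr_fun measurableSet_Ioc hin1
    rw [← e1, hsw]
    apply MeasureTheory.integral_congr_ae
    filter_upwards [hae] with r hr
    rw [← hin2 g r hr, ← hfr]

lemma fk_sg {p q : ℝ} (hp : 0 < p) (hq : 0 < q) {a t : ℝ} (hat : a ≤ t) {g : ℝ → ℝ}
    (hg : ContinuousOn g (Icc a t)) :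
    IntervalIntegrable (fun s => (t - s) ^ (p - 1) * ∫ r in a..s, (s - r) ^ (q - 1) * g r)
      volume a t ∧
    ∫ s in a..t, (t - s) ^ (p - 1) * (∫ r in a..s, (s - r) ^ (q - 1) * g r) =
      fkB p q * ∫ r in a..t, (t - r) ^ (p + q - 1) * g r := by
  set g' : ℝ → ℝ := IccExtend hat ((Icc a t).domRestrict g) with hg'
  have hc : Continuous g' := (continuousOn_iff_continuous_domRestrict.1 hg).Icc_extend'
  have heq : ∀ r ∈ Icc a t, g' r = g r := fun r hr => by
    rw [hg', IccExtend_of_mem _ _ hr]; rfl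
  have hin : ∀ s ∈ Icc a t, ∫ r in a..s, (s - r) ^ (q - 1) * g' r
      = ∫ r in a..s, (s - r) ^ (q - 1) * g r := by
    intro s hs
    apply intervalIntegral.integral_congr
    intro r hr
    rw [uIcc_of_le hs.1] at hr
    simp only
    rw [heq r ⟨hr.1, hr.2.trans hs.2⟩]
  obtain ⟨h1, h2⟩ := fk_sg_aux hp hq hat hc
  constructor
  · refine h1.congr ?_
    intro s hs
    rw [uIoc_of_le hat] at hs
    simp only
    rw [hin s ⟨hs.1.le, hs.2⟩]
  · have e1 : ∫ s in a..t, (t - s) ^ (p - 1) * (∫ r in a..s, (s - r) ^ (q - 1) * g r)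
        = ∫ s in a..t, (t - s) ^ (p - 1) * (∫ r in a..s, (s - r) ^ (q - 1) * g' r) := by
      apply intervalIntegral.integral_congr
      intro s hs
      rw [uIcc_of_le hat] at hs
      simp only
      rw [hin s hs]
    have e2 : ∫ r in a..t, (t - r) ^ (p + q - 1) * g r
        = ∫ r in a..t, (t - r) ^ (p + q - 1) * g' r := by
      apply intervalIntegral.integral_congr
      intro s hs
      rw [uIcc_of_le hat] at hs
      simp only
      rw [heq s hs]
    rw [e1, e2, h2]

lemma fk_mul_int {p : ℝ} (hp : 0 < p) {x c d : ℝ} {g : ℝ → ℝ} (hcd : c ≤ d)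
    (hg : ContinuousOn g (Icc c d)) :
    IntervalIntegrable (fun s => (x - s) ^ (p - 1) * g s) volume c d :=
  (fk_ker_int hp x c d).mul_continuousOn (by rwa [uIcc_of_le hcd])

/-- Key spatial lemma: at a zero minimum of `k`, the fractional integral of `k'` cannot be
strictly decreasing around. -/
lemma fk_space {γ : ℝ} (h0 : 0 < γ) (h1 : γ < 1) {a x₁ x₀ c : ℝ} (ha : a < x₁) (hx : x₁ < x₀)
    (hc : x₀ < c) {k k' : ℝ → ℝ} (hk : ∀ x ∈ Icc a c, HasDerivAt k (k' x) x)
    (hk' : ContinuousOn k' (Icc a c)) (hpos : ∀ x ∈ Icc a c, 0 ≤ k x) (hz : k x₀ = 0)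
    (hH : StrictAntiOn (fun x => ∫ s in a..x, (x - s) ^ (-γ) * k' s) (Icc x₁ c)) : False := by
  have eγ : -γ = (1 - γ) - 1 := by ring
  have hq : 0 < 1 - γ := by linarith
  have hkc : ContinuousOn k (Icc a c) := fun x hx => (hk x hx).continuousAt.continuousWithinAt
  set N : ℝ → ℝ := fun x => (∫ s in x₁..x, (x - s) ^ (-γ) * k' s) + (x - x₁) ^ (-γ) * k x₁ with hN
  -- far part, integrated by parts
  have hfar : ∀ x ∈ Ioc x₁ c, ∫ s in a..x₁, (x - s) ^ (-γ) * k' s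
      = (x - x₁) ^ (-γ) * k x₁ - (x - a) ^ (-γ) * k a
        - ∫ s in a..x₁, (γ * (x - s) ^ (-γ - 1)) * k s := by
    intro x hx'
    have hd : ∀ s ∈ uIcc a x₁, HasDerivAt (fun s => (x - s) ^ (-γ)) (γ * (x - s) ^ (-γ - 1)) s := by
      intro s hs
      rw [uIcc_of_le ha.le] at hs
      have hne : x - s ≠ 0 := by have := hs.2; have := hx'.1; intro h; linarith
      have := ((hasDerivAt_id s).const_sub x).rpow_const (p := -γ) (Or.inl hne)
      refine this.congr_deriv ?_
      simp
    apply intervalIntegral.integral_mul_deriv_eq_deriv_mul hd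
    · intro s hs
      rw [uIcc_of_le ha.le] at hs
      exact hk s ⟨hs.1, by linarith [hs.2]⟩
    · apply ContinuousOn.intervalIntegrable
      intro s hs
      rw [uIcc_of_le ha.le] at hs
      have hne : x - s ≠ 0 := by have := hs.2; have := hx'.1; intro h; linarith
      exact (continuousAt_const.mul
        ((continuousAt_const.sub continuousAt_id).rpow_const (Or.inl hne))).continuousWithinAt
    · apply ContinuousOn.intervalIntegrable
      rw [uIcc_of_le ha.le]
      exact hk'.mono (Icc_subset_Icc_right (by linarith))
  have hsplit : ∀ x ∈ Ioc x₁ c, ∫ s in a..x, (x - s) ^ (-γ) * k' s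
      = N x + (- (x - a) ^ (-γ) * k a - ∫ s in a..x₁, (γ * (x - s) ^ (-γ - 1)) * k s) := by
    intro x hx'
    have i1 : IntervalIntegrable (fun s => (x - s) ^ (-γ) * k' s) volume a x₁ := by
      rw [eγ]; exact fk_mul_int hq ha.le (hk'.mono (Icc_subset_Icc_right (by linarith)))
    have i2 : IntervalIntegrable (fun s => (x - s) ^ (-γ) * k' s) volume x₁ x := by
      rw [eγ]; exact fk_mul_int hq hx'.1.le (hk'.mono (Icc_subset_Icc ha.le hx'.2))
    rw [← intervalIntegral.integral_add_adjacent_intervals i1 i2, hfar x hx', hN]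
    ring
  have hNanti : ∀ x ∈ Ioc x₁ c, ∀ y ∈ Ioc x₁ c, x < y → N y < N x := by
    intro x hx' y hy' hxy
    have h := hH (Ioc_subset_Icc_self hx') (Ioc_subset_Icc_self hy') hxy
    simp only at h
    rw [hsplit x hx', hsplit y hy'] at h
    have m1 : (y - a) ^ (-γ) * k a ≤ (x - a) ^ (-γ) * k a := by
      apply mul_le_mul_of_nonneg_right _ (hpos a ⟨le_rfl, by linarith⟩)
      exact Real.rpow_le_rpow_of_nonpos (by linarith [hx'.1]) (by linarith) (by linarith)
    have ci : ∀ z ∈ Ioc x₁ c, IntervalIntegrable (fun s => (γ * (z - s) ^ (-γ - 1)) * k s)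
        volume a x₁ := by
      intro z hz'
      apply ContinuousOn.intervalIntegrable
      rw [uIcc_of_le ha.le]
      apply ContinuousOn.mul _ (hkc.mono (Icc_subset_Icc_right (by linarith)))
      intro s hs
      have hne : z - s ≠ 0 := by have := hs.2; have := hz'.1; intro h; linarith
      exact (continuousAt_const.mul
        ((continuousAt_const.sub continuousAt_id).rpow_const (Or.inl hne))).continuousWithinAt
    have m2 : ∫ s in a..x₁, (γ * (y - s) ^ (-γ - 1)) * k s
        ≤ ∫ s in a..x₁, (γ * (x - s) ^ (-γ - 1)) * k s := by
      apply intervalIntegral.integral_mono_on ha.le (ci y hy') (ci x hx')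
      intro s hs
      apply mul_le_mul_of_nonneg_right _ (hpos s ⟨hs.1, by linarith [hs.2]⟩)
      apply mul_le_mul_of_nonneg_left _ h0.le
      exact Real.rpow_le_rpow_of_nonpos (by linarith [hx'.1, hs.2]) (by linarith) (by linarith)
    linarith
  -- inversion
  have hinv : ∀ x ∈ Ioc x₁ c, IntervalIntegrable (fun s => (x - s) ^ (γ - 1) * N s) volume x₁ x ∧
      ∫ s in x₁..x, (x - s) ^ (γ - 1) * N s = fkB γ (1 - γ) * k x := by
    intro x hx'
    obtain ⟨i1, e1⟩ := fk_sg h0 hq hx'.1.le (hk'.mono (Icc_subset_Icc ha.le hx'.2))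
    have i2 := (fk_beta_int h0 hq hx'.1).mul_const (k x₁)
    have e2 := fk_beta_scaled γ (1 - γ) hx'.1
    have hfun : (fun s => (x - s) ^ (γ - 1) * N s) = fun s =>
        ((x - s) ^ (γ - 1) * ∫ r in x₁..s, (s - r) ^ (1 - γ - 1) * k' r)
        + (x - s) ^ (γ - 1) * (s - x₁) ^ (1 - γ - 1) * k x₁ := by
      ext s
      rw [hN, ← eγ]; ring
    rw [hfun]
    refine ⟨i1.add i2, ?_⟩
    rw [intervalIntegral.integral_add i1 i2, e1, intervalIntegral.integral_mul_const, e2]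
    have e3 : γ + (1 - γ) - 1 = 0 := by ring
    simp only [e3, Real.rpow_zero, one_mul]
    have : ∫ r in x₁..x, k' r = k x - k x₁ := by
      apply intervalIntegral.integral_eq_sub_of_hasDerivAt
      · intro s hs
        rw [uIcc_of_le hx'.1.le] at hs
        exact hk s ⟨by linarith [hs.1], hs.2.trans hx'.2⟩
      · apply ContinuousOn.intervalIntegrable
        rw [uIcc_of_le hx'.1.le]
        exact hk'.mono (Icc_subset_Icc ha.le hx'.2)
    rw [this]; ring
  obtain ⟨ic, ec⟩ := hinv c ⟨by linarith, le_rfl⟩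
  obtain ⟨i0, e0⟩ := hinv x₀ ⟨hx, hc.le⟩
  rw [hz, mul_zero] at e0
  set ρ : ℝ := (c - x₁) / (x₀ - x₁) with hρ
  have hd : 0 < x₀ - x₁ := by linarith
  have hρ1 : 1 < ρ := by rw [hρ, one_lt_div hd]; linarith
  have hρ0 : 0 < ρ := by linarith
  have hρe : ρ * (x₀ - x₁) = c - x₁ := by rw [hρ]; field_simp
  have eA : ρ * x₁ + (x₁ - ρ * x₁) = x₁ := by ring
  have eB : ρ * x₀ + (x₁ - ρ * x₁) = c := by linarith
  have hsub := intervalIntegral.smul_integral_comp_mul_add (a := x₁) (b := x₀)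
    (fun s => (c - s) ^ (γ - 1) * N s) ρ (x₁ - ρ * x₁)
  rw [eA, eB, ec] at hsub
  have isub : IntervalIntegrable (fun y => (c - (ρ * y + (x₁ - ρ * x₁))) ^ (γ - 1)
      * N (ρ * y + (x₁ - ρ * x₁))) volume x₁ x₀ := by
    have h1 := (ic.comp_add_right (x₁ - ρ * x₁)).comp_mul_left (c := ρ)
    have f1 : (x₁ - (x₁ - ρ * x₁)) / ρ = x₁ := by field_simp; ring
    have f2 : (c - (x₁ - ρ * x₁)) / ρ = x₀ := by rw [div_eq_iff hρ0.ne']; linarith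
    rwa [f1, f2] at h1
  have hrew : ∀ y ∈ Icc x₁ x₀, (c - (ρ * y + (x₁ - ρ * x₁))) ^ (γ - 1)
      = ρ ^ (γ - 1) * (x₀ - y) ^ (γ - 1) := by
    intro y hy
    rw [← Real.mul_rpow hρ0.le (by linarith [hy.2])]
    congr 1
    linarith
  have hρp := Real.rpow_pos_of_pos hρ0 (γ - 1)
  have hlt : 0 < ∫ y in x₁..x₀, (ρ ^ (γ - 1) * ((x₀ - y) ^ (γ - 1) * N y)
      - (c - (ρ * y + (x₁ - ρ * x₁))) ^ (γ - 1) * N (ρ * y + (x₁ - ρ * x₁))) := by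
    apply intervalIntegral_pos_of_pos_on ((i0.const_mul _).sub isub) _ hx
    intro y hy
    rw [hrew y (Ioo_subset_Icc_self hy)]
    have hyl : y < ρ * y + (x₁ - ρ * x₁) := by nlinarith [hy.1]
    have hyc : ρ * y + (x₁ - ρ * x₁) ≤ c := by nlinarith [hy.2]
    have := hNanti y ⟨hy.1, by linarith [hy.2]⟩ (ρ * y + (x₁ - ρ * x₁))
      ⟨by linarith [hy.1], hyc⟩ hyl
    have hp := mul_pos hρp (Real.rpow_pos_of_pos (show 0 < x₀ - y by linarith [hy.2]) (γ - 1))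
    nlinarith
  rw [intervalIntegral.integral_sub (i0.const_mul _) isub, intervalIntegral.integral_const_mul, e0,
    mul_zero, zero_sub] at hlt
  have hB := fkB_pos h0 hq
  have := mul_nonneg hB.le (hpos c ⟨by linarith, le_rfl⟩)
  rw [← hsub, smul_eq_mul] at this
  nlinarith

/-- Key time lemma. -/
lemma fk_time {α : ℝ} (h0 : 0 < α) (h1 : α < 1) {t₀ κ C η : ℝ} (ht : 0 < t₀) (hκ : 0 < κ)
    (hη : 0 < η) (hη' : η < t₀)
    {f g : ℝ → ℝ} (hf : ContinuousOn f (Icc 0 t₀)) (hg : ContinuousOn g (Icc 0 t₀))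
    (hmax : ∀ s ∈ Icc 0 t₀, f s ≤ f t₀) (hM : 0 < f t₀)
    (hlip : ∀ s ∈ Icc (t₀ - η) t₀, f t₀ - f s ≤ C * (t₀ - s))
    (heq : ∀ t ∈ Icc 0 t₀, ∫ s in (0:ℝ)..t, (t - s) ^ (-α) * f s = κ * ∫ s in (0:ℝ)..t, g s) :
    0 < g t₀ := by
  by_contra hng
  push Not at hng
  have eα : -α = (1 - α) - 1 := by ring
  have hq : 0 < 1 - α := by linarith
  set M := f t₀ with hMdef
  set m : ℝ := M * t₀ ^ (-α) with hm
  have hmpos : 0 < m := mul_pos hM (Real.rpow_pos_of_pos ht _)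
  have hC : 0 ≤ C := by
    have := hlip (t₀ - η) ⟨le_rfl, by linarith⟩
    have h2 := hmax (t₀ - η) ⟨by linarith, by linarith⟩
    have : 0 ≤ C * η := by linarith [show C * (t₀ - (t₀ - η)) = C * η by ring]
    exact nonneg_of_mul_nonneg_left this hη
  -- near `t₀`, `g ≤ m / (2κ)`
  have hnear : ∃ ζ > 0, ∀ s ∈ Icc 0 t₀, t₀ - ζ < s → g s ≤ m / (2 * κ) := by
    have := Metric.continuousWithinAt_iff.1 (hg t₀ ⟨ht.le, le_rfl⟩) (m / (2 * κ)) (by positivity)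
    obtain ⟨ζ, hζ, H⟩ := this
    refine ⟨ζ, hζ, fun s hs hs' => ?_⟩
    have := H hs (by rw [Real.dist_eq, abs_lt]; constructor <;> linarith [hs.2])
    rw [Real.dist_eq, abs_lt] at this
    linarith [this.2]
  obtain ⟨ζ, hζ, hgζ⟩ := hnear
  -- the main inequality
  have hmain : ∀ h, 0 < h → h < η → h < ζ → m ≤ m / 2 + C * h ^ (1 - α) := by
    intro h hh hhη hhζ
    set t := t₀ - h with htdef
    have ht0 : 0 < t := by linarith
    have htt : t < t₀ := by linarith
    have hsub1 : Icc 0 t ⊆ Icc 0 t₀ := Icc_subset_Icc_right htt.le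
    have hsub2 : Icc t t₀ ⊆ Icc 0 t₀ := Icc_subset_Icc_left ht0.le
    have E1 := heq t₀ ⟨ht.le, le_rfl⟩
    have E2 := heq t ⟨ht0.le, htt.le⟩
    have hkc : ContinuousOn (fun s => M - f s) (Icc 0 t₀) := continuousOn_const.sub hf
    -- integrability
    have j1 : IntervalIntegrable (fun s => (t₀ - s) ^ (-α) * (M - f s)) volume 0 t := by
      rw [eα]; exact fk_mul_int hq ht0.le (hkc.mono hsub1)
    have j2 : IntervalIntegrable (fun s => (t₀ - s) ^ (-α) * (M - f s)) volume t t₀ := by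
      rw [eα]; exact fk_mul_int hq htt.le (hkc.mono hsub2)
    have j3 : IntervalIntegrable (fun s => (t - s) ^ (-α) * (M - f s)) volume 0 t := by
      rw [eα]; exact fk_mul_int hq ht0.le (hkc.mono hsub1)
    have j4 : ∀ z c d, IntervalIntegrable (fun s : ℝ => (z - s) ^ (-α)) volume c d := by
      intro z c d; rw [eα]; exact fk_ker_int hq _ _ _
    have dec : ∀ z, 0 ≤ z → z ≤ t₀ → ∫ s in (0:ℝ)..z, (z - s) ^ (-α) * f s
        = M * (∫ s in (0:ℝ)..z, s ^ (-α)) - ∫ s in (0:ℝ)..z, (z - s) ^ (-α) * (M - f s) := by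
      intro z hz hz'
      have e1 : ∫ s in (0:ℝ)..z, s ^ (-α) = ∫ s in (0:ℝ)..z, (z - s) ^ (-α) := by
        have := intervalIntegral.integral_comp_sub_left (a := 0) (b := z)
          (fun s : ℝ => s ^ (-α)) z
        rw [this]; simp
      have j5 : IntervalIntegrable (fun s => (z - s) ^ (-α) * (M - f s)) volume 0 z := by
        rw [eα]; exact fk_mul_int hq hz (hkc.mono (Icc_subset_Icc_right hz'))
      rw [e1, ← intervalIntegral.integral_const_mul,
        ← intervalIntegral.integral_sub ((j4 z 0 z).const_mul M) j5]
      congr 1; ext s; ring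
    rw [dec t₀ ht.le le_rfl] at E1
    rw [dec t ht0.le htt.le] at E2
    -- power part
    have P : m * h ≤ M * (∫ s in (0:ℝ)..t₀, s ^ (-α)) - M * ∫ s in (0:ℝ)..t, s ^ (-α) := by
      have r : ∀ c d, IntervalIntegrable (fun s : ℝ => s ^ (-α)) volume c d :=
        fun c d => intervalIntegral.intervalIntegrable_rpow' (by linarith)
      rw [← mul_sub, intervalIntegral.integral_interval_sub_left (r _ _) (r _ _)]
      have : ∫ s in t..t₀, t₀ ^ (-α) ≤ ∫ s in t..t₀, s ^ (-α) := by
        apply intervalIntegral.integral_mono_on htt.le (by simp) (r _ _)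
        intro s hs
        exact Real.rpow_le_rpow_of_nonpos (by linarith [hs.1]) hs.2 (by linarith)
      rw [intervalIntegral.integral_const, smul_eq_mul, show t₀ - t = h by rw [htdef]; ring] at this
      rw [hm]
      nlinarith
    -- comparison part
    have Q1 : ∫ s in (0:ℝ)..t, (t₀ - s) ^ (-α) * (M - f s)
        ≤ ∫ s in (0:ℝ)..t, (t - s) ^ (-α) * (M - f s) := by
      apply intervalIntegral.integral_mono_on_of_le_Ioo ht0.le j1 j3
      intro s hs
      apply mul_le_mul_of_nonneg_right _ (by linarith [hmax s (hsub1 (Ioo_subset_Icc_self hs))])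
      exact Real.rpow_le_rpow_of_nonpos (by linarith [hs.2]) (by linarith) (by linarith)
    have Q2 : ∫ s in t..t₀, (t₀ - s) ^ (-α) * (M - f s) ≤ h * (C * h ^ (1 - α)) := by
      have : ∫ s in t..t₀, (t₀ - s) ^ (-α) * (M - f s) ≤ ∫ s in t..t₀, C * h ^ (1 - α) := by
        apply intervalIntegral.integral_mono_on_of_le_Ioo htt.le j2 (by simp)
        intro s hs
        have hp : 0 < t₀ - s := by linarith [hs.2]
        calc (t₀ - s) ^ (-α) * (M - f s) ≤ (t₀ - s) ^ (-α) * (C * (t₀ - s)) :=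
              mul_le_mul_of_nonneg_left (hlip s ⟨by linarith [hs.1], hs.2.le⟩)
                (Real.rpow_nonneg hp.le _)
          _ = C * (t₀ - s) ^ (1 - α) := by
              rw [show 1 - α = -α + 1 by ring, Real.rpow_add hp, Real.rpow_one]; ring
          _ ≤ C * h ^ (1 - α) := by
              apply mul_le_mul_of_nonneg_left _ hC
              exact Real.rpow_le_rpow hp.le (by linarith [hs.1]) hq.le
      rwa [intervalIntegral.integral_const, smul_eq_mul, show t₀ - t = h by rw [htdef]; ring] at this
    -- right-hand side
    have R : κ * (∫ s in (0:ℝ)..t₀, g s) - κ * ∫ s in (0:ℝ)..t, g s ≤ m / 2 * h := by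
      have gi : ∀ c d, c ≤ d → Icc c d ⊆ Icc 0 t₀ → IntervalIntegrable g volume c d := by
        intro c d hcd hs
        apply ContinuousOn.intervalIntegrable
        rw [uIcc_of_le hcd]; exact hg.mono hs
      rw [← mul_sub, intervalIntegral.integral_interval_sub_left
        (gi _ _ ht.le Subset.rfl) (gi _ _ ht0.le hsub1)]
      have : ∫ s in t..t₀, g s ≤ ∫ s in t..t₀, m / (2 * κ) := by
        apply intervalIntegral.integral_mono_on htt.le (gi _ _ htt.le hsub2) (by simp)
        intro s hs
        exact hgζ s (hsub2 hs) (by linarith [hs.1])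
      rw [intervalIntegral.integral_const, smul_eq_mul, show t₀ - t = h by rw [htdef]; ring] at this
      calc _ ≤ κ * (h * (m / (2 * κ))) := mul_le_mul_of_nonneg_left this hκ.le
        _ = m / 2 * h := by field_simp
    have S := intervalIntegral.integral_add_adjacent_intervals j1 j2
    have F : m * h ≤ (m / 2 + C * h ^ (1 - α)) * h := by
      nlinarith
    exact le_of_mul_le_mul_right F hh
  have hlim : Filter.Tendsto (fun h : ℝ => m / 2 + C * h ^ (1 - α)) (nhdsWithin 0 (Ioi 0))
      (nhds (m / 2 + C * 0 ^ (1 - α))) := by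
    apply Filter.Tendsto.mono_left _ nhdsWithin_le_nhds
    exact (continuousAt_const.add (continuousAt_const.mul
      (Real.continuousAt_rpow_const _ _ (Or.inr hq.le)))).tendsto
  rw [Real.zero_rpow hq.ne', mul_zero, add_zero] at hlim
  have := ge_of_tendsto hlim (b := m) (by
    have a1 : ∀ᶠ h in nhdsWithin (0:ℝ) (Ioi 0), h < η :=
      Filter.Eventually.filter_mono nhdsWithin_le_nhds (eventually_lt_nhds hη)
    have a2 : ∀ᶠ h in nhdsWithin (0:ℝ) (Ioi 0), h < ζ :=
      Filter.Eventually.filter_mono nhdsWithin_le_nhds (eventually_lt_nhds hζ)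
    filter_upwards [a1, a2, self_mem_nhdsWithin] with h b1 b2 b3 using hmain h b3 b1 b2)
  linarith

lemma fk_seqaux {β₁ β₂ a b : ℝ} (h1 : β₁ < 1) (h2 : β₂ < 1) {f : ℝ → ℝ}
    (hf : ContinuousOn (deriv f) (Icc a b)) {x : ℝ} (hx : x ∈ Icc a b) :
    seqCaputoAux β₁ β₂ a f x = (1 / Real.Gamma (1 - β₁) * (1 / Real.Gamma (1 - β₂))
      * fkB (1 - β₁) (1 - β₂)) * ∫ s in a..x, (x - s) ^ (-(β₁ + β₂ - 1)) * deriv f s := by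
  obtain ⟨-, h⟩ := fk_sg (p := 1 - β₁) (q := 1 - β₂) (by linarith) (by linarith) hx.1
    (hf.mono (Icc_subset_Icc_right hx.2))
  have e1 : 1 - β₁ - 1 = -β₁ := by ring
  have e2 : 1 - β₂ - 1 = -β₂ := by ring
  have e3 : 1 - β₁ + (1 - β₂) - 1 = -(β₁ + β₂ - 1) := by ring
  rw [e1, e2, e3] at h
  unfold seqCaputoAux caputo
  rw [mul_assoc, mul_assoc, ← h, ← intervalIntegral.integral_const_mul (1 / Real.Gamma (1 - β₂))]
  congr 2
  ext s
  ring

lemma fk_rl_cont {α T : ℝ} (h0 : 0 < α) (hT : 0 < T) {g : ℝ → ℝ}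
    (hg : ContinuousOn g (Icc 0 T))
    (hd : ∀ t ∈ Ioc (0:ℝ) T, HasDerivAt (rlAux (1 - α) g) (rlDeriv (1 - α) g t) t) :
    ContinuousOn (rlAux (1 - α) g) (Icc 0 T) := by
  intro t ht
  rcases eq_or_lt_of_le ht.1 with h | h
  · subst h
    have hz : rlAux (1 - α) g 0 = 0 := by simp [rlAux]
    obtain ⟨G, hG⟩ := isCompact_Icc.exists_bound_of_continuousOn hg
    have hG0 : 0 ≤ G := (norm_nonneg _).trans (hG 0 ht)
    unfold ContinuousWithinAt
    rw [hz]
    apply squeeze_zero_norm' (a := fun t : ℝ => |1 / Real.Gamma (1 - (1 - α))| * (G * (t ^ α / α)))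
    · filter_upwards [self_mem_nhdsWithin] with t ht'
      unfold rlAux
      rw [norm_mul, Real.norm_eq_abs]
      apply mul_le_mul_of_nonneg_left _ (abs_nonneg _)
      have eα : -(1 - α) = α - 1 := by ring
      rw [eα]
      have hb : ‖∫ s in (0:ℝ)..t, (t - s) ^ (α - 1) * g s‖
          ≤ ∫ s in (0:ℝ)..t, G * (t - s) ^ (α - 1) := by
        apply intervalIntegral.norm_integral_le_of_norm_le ht'.1 _ ((fk_ker_int h0 t 0 t).const_mul G)
        filter_upwards with s hs
        rw [norm_mul, Real.norm_of_nonneg (Real.rpow_nonneg (by linarith [hs.2]) _), mul_comm]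
        exact mul_le_mul_of_nonneg_right (hG s ⟨hs.1.le, hs.2.trans ht'.2⟩)
          (Real.rpow_nonneg (by linarith [hs.2]) _)
      refine hb.trans_eq ?_
      rw [intervalIntegral.integral_const_mul]
      congr 1
      have := intervalIntegral.integral_comp_sub_left (a := 0) (b := t)
          (fun s : ℝ => s ^ (α - 1)) t
      rw [this, integral_rpow (Or.inl (by linarith))]
      simp [Real.zero_rpow h0.ne']
    · have : Filter.Tendsto (fun t : ℝ => |1 / Real.Gamma (1 - (1 - α))| * (G * (t ^ α / α)))
          (nhds 0) (nhds (|1 / Real.Gamma (1 - (1 - α))| * (G * ((0:ℝ) ^ α / α)))) :=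
        (((Real.continuousAt_rpow_const 0 α (Or.inr h0.le)).tendsto.div_const α).const_mul
          G).const_mul _
      rw [Real.zero_rpow h0.ne', zero_div, mul_zero, mul_zero] at this
      exact this.mono_left nhdsWithin_le_nhds
  · exact (hd t ⟨h, ht.2⟩).continuousAt.continuousWithinAt

lemma fk_one
    (α β₁ β₂ ν a b T δ : ℝ)
    (hα : 0 < α ∧ α < 1) (hβ₁ : 0 < β₁ ∧ β₁ < 1) (hβ₂ : 0 < β₂ ∧ β₂ < 1)
    (hsum : 1 < β₁ + β₂) (hν : 0 < ν) (hδ : 0 < δ)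
    (F : ℝ → ℝ → ℝ) (u v : ℝ → ℝ → ℝ)
    (hu : ContinuousOn (Function.uncurry u) (Set.Icc a b ×ˢ Set.Icc 0 T))
    (hux : ∀ t ∈ Set.Icc (0:ℝ) T, ∀ x ∈ Set.Icc a b,
      HasDerivAt (fun y => u y t) (deriv (fun y => u y t) x) x)
    (hux' : ∀ t ∈ Set.Icc (0:ℝ) T, ContinuousOn (deriv (fun y => u y t)) (Set.Icc a b))
    (hut : ∀ x ∈ Set.Icc a b, ∀ t ∈ Set.Ioc (0:ℝ) T, HasDerivAt (u x) (deriv (u x) t) t)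
    (hDxexu : ∀ t ∈ Set.Icc (0:ℝ) T, ∀ x ∈ Set.Ioo a b,
      HasDerivAt (seqCaputoAux β₁ β₂ a (fun y => u y t))
        (seqCaputo β₁ β₂ a (fun y => u y t) x) x)
    (hwu : ContinuousOn (fun p : ℝ × ℝ => seqCaputo β₁ β₂ a (fun y => u y p.2) p.1)
      (Set.Icc a b ×ˢ Set.Icc 0 T))
    (hrlexu : ∀ x ∈ Set.Icc a b, ∀ t ∈ Set.Ioc (0:ℝ) T,
      HasDerivAt (rlAux (1 - α) (fun τ => seqCaputo β₁ β₂ a (fun y => u y τ) x))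
        (rlDeriv (1 - α) (fun τ => seqCaputo β₁ β₂ a (fun y => u y τ) x) t) t)
    (hv : ContinuousOn (Function.uncurry v) (Set.Icc a b ×ˢ Set.Icc 0 T))
    (hvx : ∀ t ∈ Set.Icc (0:ℝ) T, ∀ x ∈ Set.Icc a b,
      HasDerivAt (fun y => v y t) (deriv (fun y => v y t) x) x)
    (hvx' : ∀ t ∈ Set.Icc (0:ℝ) T, ContinuousOn (deriv (fun y => v y t)) (Set.Icc a b))
    (hvt : ∀ x ∈ Set.Icc a b, ∀ t ∈ Set.Ioc (0:ℝ) T, HasDerivAt (v x) (deriv (v x) t) t)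
    (hDxexv : ∀ t ∈ Set.Icc (0:ℝ) T, ∀ x ∈ Set.Ioo a b,
      HasDerivAt (seqCaputoAux β₁ β₂ a (fun y => v y t))
        (seqCaputo β₁ β₂ a (fun y => v y t) x) x)
    (hwv : ContinuousOn (fun p : ℝ × ℝ => seqCaputo β₁ β₂ a (fun y => v y p.2) p.1)
      (Set.Icc a b ×ˢ Set.Icc 0 T))
    (hrlexv : ∀ x ∈ Set.Icc a b, ∀ t ∈ Set.Ioc (0:ℝ) T,
      HasDerivAt (rlAux (1 - α) (fun τ => seqCaputo β₁ β₂ a (fun y => v y τ) x))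
        (rlDeriv (1 - α) (fun τ => seqCaputo β₁ β₂ a (fun y => v y τ) x) t) t)
    (hequ : ∀ x ∈ Set.Ioo a b, ∀ t ∈ Set.Ioc (0:ℝ) T,
      deriv (u x) t
        = ν * rlDeriv (1 - α) (fun τ => seqCaputo β₁ β₂ a (fun y => u y τ) x) t + F x t)
    (heqv : ∀ x ∈ Set.Ioo a b, ∀ t ∈ Set.Ioc (0:ℝ) T,
      deriv (v x) t
        = ν * rlDeriv (1 - α) (fun τ => seqCaputo β₁ β₂ a (fun y => v y τ) x) t + F x t)
    (hbd : ∀ t ∈ Set.Icc (0:ℝ) T, u a t = v a t ∧ u b t = v b t)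
    (hinit : ∀ x ∈ Set.Icc a b, u x 0 - v x 0 ≤ δ) :
    ∀ x ∈ Set.Icc a b, ∀ t ∈ Set.Icc (0:ℝ) T, u x t - v x t ≤ δ := by
  intro x hx t ht
  by_contra hcon
  push Not at hcon
  -- maximum point
  obtain ⟨⟨x₀, t₀⟩, hmem, hmaxp⟩ := (isCompact_Icc.prod isCompact_Icc).exists_isMaxOn
    (s := Icc a b ×ˢ Icc 0 T) ⟨(x, t), hx, ht⟩ (hu.sub hv)
  have hx₀ : x₀ ∈ Icc a b := hmem.1
  have ht₀ : t₀ ∈ Icc 0 T := hmem.2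
  have hmax : ∀ y ∈ Icc a b, ∀ s ∈ Icc 0 T, u y s - v y s ≤ u x₀ t₀ - v x₀ t₀ :=
    fun y hy s hs => hmaxp (show (y, s) ∈ Icc a b ×ˢ Icc 0 T from ⟨hy, hs⟩)
  clear hmaxp
  have hbig : δ < u x₀ t₀ - v x₀ t₀ := hcon.trans_le (hmax x hx t ht)
  clear hcon hx ht x t
  have hxa : a < x₀ := by
    rcases eq_or_lt_of_le hx₀.1 with h | h
    · have := (hbd t₀ ht₀).1; rw [← h] at hbig; linarith
    · exact h
  have hxb : x₀ < b := by
    rcases eq_or_lt_of_le hx₀.2 with h | h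
    · have := (hbd t₀ ht₀).2; rw [h] at hbig; linarith
    · exact h
  have ht0 : 0 < t₀ := by
    rcases eq_or_lt_of_le ht₀.1 with h | h
    · have := hinit x₀ hx₀; rw [← h] at hbig; linarith
    · exact h
  set g : ℝ → ℝ → ℝ := fun x t => seqCaputo β₁ β₂ a (fun y => u y t) x
    - seqCaputo β₁ β₂ a (fun y => v y t) x with hg
  -- spatial sign
  have hspace : g x₀ t₀ ≤ 0 := by
    by_contra hgp
    push Not at hgp
    have hgc : ContinuousAt (fun x => g x t₀) x₀ := by
      have c1 : ContinuousOn (fun x => g x t₀) (Icc a b) :=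
        (hwu.sub hwv).comp (f := fun x => (x, t₀)) (by fun_prop) (fun x hx => ⟨hx, ht₀⟩)
      exact c1.continuousAt (Icc_mem_nhds hxa hxb)
    obtain ⟨ε, hε, hgε⟩ := Metric.eventually_nhds_iff.1 (hgc.eventually (lt_mem_nhds hgp))
    obtain ⟨r, hr0, hr1, hr2, hr3⟩ : ∃ r > 0, r < ε ∧ r < x₀ - a ∧ r < b - x₀ := by
      obtain ⟨r, h1, h2⟩ := exists_between (show 0 < min ε (min (x₀ - a) (b - x₀)) by
        apply lt_min hε (lt_min _ _) <;> linarith)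
      exact ⟨r, h1, (lt_min_iff.1 h2).1, (lt_min_iff.1 (lt_min_iff.1 h2).2).1,
        (lt_min_iff.1 (lt_min_iff.1 h2).2).2⟩
    have hgpos : ∀ x ∈ Icc (x₀ - r) (x₀ + r), 0 < g x t₀ := by
      intro x hx
      apply hgε
      rw [Real.dist_eq, abs_lt]
      constructor <;> linarith [hx.1, hx.2]
    have hsub : Icc a (x₀ + r) ⊆ Icc a b := Icc_subset_Icc_right (by linarith)
    have hA : StrictMonoOn (fun x => seqCaputoAux β₁ β₂ a (fun y => u y t₀) x
        - seqCaputoAux β₁ β₂ a (fun y => v y t₀) x) (Icc (x₀ - r) (x₀ + r)) := by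
      have hd : ∀ x ∈ Icc (x₀ - r) (x₀ + r), HasDerivAt (fun x =>
          seqCaputoAux β₁ β₂ a (fun y => u y t₀) x
          - seqCaputoAux β₁ β₂ a (fun y => v y t₀) x) (g x t₀) x := by
        intro x hx
        have hx' : x ∈ Ioo a b := ⟨by linarith [hx.1], by linarith [hx.2]⟩
        exact (hDxexu t₀ ht₀ x hx').sub (hDxexv t₀ ht₀ x hx')
      apply strictMonoOn_of_deriv_pos (convex_Icc _ _)
      · exact fun x hx => (hd x hx).continuousAt.continuousWithinAt
      · intro x hx
        rw [(hd x (interior_subset hx)).deriv]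
        exact hgpos x (interior_subset hx)
    set D : ℝ := 1 / Real.Gamma (1 - β₁) * (1 / Real.Gamma (1 - β₂)) * fkB (1 - β₁) (1 - β₂)
      with hDdef
    have hD : 0 < D := by
      have g1 := Real.Gamma_pos_of_pos (show 0 < 1 - β₁ by linarith [hβ₁.2])
      have g2 := Real.Gamma_pos_of_pos (show 0 < 1 - β₂ by linarith [hβ₂.2])
      have g3 := fkB_pos (show 0 < 1 - β₁ by linarith [hβ₁.2])
        (show 0 < 1 - β₂ by linarith [hβ₂.2])
      positivity
    set k : ℝ → ℝ := fun x => (u x₀ t₀ - v x₀ t₀) - (u x t₀ - v x t₀) with hk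
    set k' : ℝ → ℝ := fun x => -(deriv (fun y => u y t₀) x - deriv (fun y => v y t₀) x) with hk'
    have hform : ∀ x ∈ Icc a b, seqCaputoAux β₁ β₂ a (fun y => u y t₀) x
        - seqCaputoAux β₁ β₂ a (fun y => v y t₀) x
        = - (D * ∫ s in a..x, (x - s) ^ (-(β₁ + β₂ - 1)) * k' s) := by
      intro x hx
      rw [fk_seqaux hβ₁.2 hβ₂.2 (hux' t₀ ht₀) hx, fk_seqaux hβ₁.2 hβ₂.2 (hvx' t₀ ht₀) hx,
        ← hDdef, ← mul_sub, ← mul_neg]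
      have hsx : Icc a x ⊆ Icc a b := Icc_subset_Icc_right hx.2
      have e : -(β₁ + β₂ - 1) = (2 - β₁ - β₂) - 1 := by ring
      have hp : 0 < 2 - β₁ - β₂ := by linarith [hβ₁.2, hβ₂.2]
      rw [e, ← intervalIntegral.integral_sub (fk_mul_int hp hx.1 ((hux' t₀ ht₀).mono hsx))
        (fk_mul_int hp hx.1 ((hvx' t₀ ht₀).mono hsx)), ← intervalIntegral.integral_neg]
      congr 2
      ext s
      rw [hk']; ring
    apply fk_space (γ := β₁ + β₂ - 1) (a := a) (x₁ := x₀ - r) (x₀ := x₀) (c := x₀ + r)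
      (k := k) (k' := k') (by linarith) (by linarith [hβ₁.2, hβ₂.2]) (by linarith) (by linarith)
      (by linarith)
    · intro x hx
      have := ((hux t₀ ht₀ x (hsub hx)).sub (hvx t₀ ht₀ x (hsub hx))).const_sub
        (u x₀ t₀ - v x₀ t₀)
      exact this
    · exact (((hux' t₀ ht₀).mono hsub).sub ((hvx' t₀ ht₀).mono hsub)).neg
    · intro x hx
      have := hmax x (hsub hx) t₀ ht₀
      simp only [hk]; linarith
    · simp [hk]
    · intro x hx y hy hxy
      have h := hA hx hy hxy
      simp only at h ⊢
      rw [hform x ⟨by linarith [hx.1], by linarith [hx.2]⟩,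
        hform y ⟨by linarith [hy.1], by linarith [hy.2]⟩] at h
      exact lt_of_mul_lt_mul_left (neg_lt_neg_iff.1 h) hD.le
  -- time sign
  have hgtu : ContinuousOn (fun t => seqCaputo β₁ β₂ a (fun y => u y t) x₀) (Icc 0 T) :=
    hwu.comp (f := fun t => (x₀, t)) (by fun_prop) (fun t ht => ⟨hx₀, ht⟩)
  have hgtv : ContinuousOn (fun t => seqCaputo β₁ β₂ a (fun y => v y t) x₀) (Icc 0 T) :=
    hwv.comp (f := fun t => (x₀, t)) (by fun_prop) (fun t ht => ⟨hx₀, ht⟩)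
  have hgt : ContinuousOn (fun t => g x₀ t) (Icc 0 T) := hgtu.sub hgtv
  have hutc : ContinuousOn (fun t => u x₀ t) (Icc 0 T) :=
    hu.comp (f := fun t => (x₀, t)) (by fun_prop) (fun t ht => ⟨hx₀, ht⟩)
  have hvtc : ContinuousOn (fun t => v x₀ t) (Icc 0 T) :=
    hv.comp (f := fun t => (x₀, t)) (by fun_prop) (fun t ht => ⟨hx₀, ht⟩)
  have hTpos : 0 < T := ht0.trans_le ht₀.2
  have hru := fk_rl_cont hα.1 hTpos hgtu (hrlexu x₀ hx₀)
  have hrv := fk_rl_cont hα.1 hTpos hgtv (hrlexv x₀ hx₀)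
  set c₀ : ℝ := ν * (1 / Real.Gamma α) with hc₀
  have hc₀pos : 0 < c₀ := by
    have := Real.Gamma_pos_of_pos hα.1
    positivity
  set f : ℝ → ℝ := fun t => (u x₀ t - v x₀ t) - (u x₀ 0 - v x₀ 0) with hf
  have hfint : ∀ t ∈ Icc 0 T, f t = c₀ * ∫ s in (0:ℝ)..t, (t - s) ^ (α - 1) * g x₀ s := by
    intro t ht
    have hI : f t = ν * (rlAux (1 - α) (fun τ => seqCaputo β₁ β₂ a (fun y => u y τ) x₀) t
        - rlAux (1 - α) (fun τ => seqCaputo β₁ β₂ a (fun y => v y τ) x₀) t) := by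
      rcases eq_or_lt_of_le ht.1 with h | h
      · rw [← h]; simp [hf, rlAux]
      · have hsT : Icc 0 t ⊆ Icc 0 T := Icc_subset_Icc_right ht.2
        obtain ⟨ξ, hξ, hs⟩ := exists_hasDerivAt_eq_slope
          (fun t => (u x₀ t - v x₀ t) -
            ν * (rlAux (1 - α) (fun τ => seqCaputo β₁ β₂ a (fun y => u y τ) x₀) t
              - rlAux (1 - α) (fun τ => seqCaputo β₁ β₂ a (fun y => v y τ) x₀) t))
          (fun _ => 0) h
          (((hutc.sub hvtc).sub (continuousOn_const.mul (hru.sub hrv))).mono hsT)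
          (by
            intro s hs
            have hsm : s ∈ Ioc 0 T := ⟨hs.1, by linarith [hs.2, ht.2]⟩
            have h1 := ((hut x₀ hx₀ s hsm).sub (hvt x₀ hx₀ s hsm)).sub
              (((hrlexu x₀ hx₀ s hsm).sub (hrlexv x₀ hx₀ s hsm)).const_mul ν)
            refine h1.congr_deriv ?_
            rw [hequ x₀ ⟨hxa, hxb⟩ s hsm, heqv x₀ ⟨hxa, hxb⟩ s hsm]
            ring)
        have hs' := hs.symm
        rw [div_eq_zero_iff] at hs'
        rcases hs' with hs' | hs'
        · have z1 : rlAux (1 - α) (fun τ => seqCaputo β₁ β₂ a (fun y => u y τ) x₀) 0 = 0 := by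
            simp [rlAux]
          have z2 : rlAux (1 - α) (fun τ => seqCaputo β₁ β₂ a (fun y => v y τ) x₀) 0 = 0 := by
            simp [rlAux]
          rw [z1, z2] at hs'
          simp only [hf]; linarith
        · linarith
    rw [hI]
    unfold rlAux
    have e : -(1 - α) = α - 1 := by ring
    have e' : 1 - (1 - α) = α := by ring
    have hst : Icc 0 t ⊆ Icc 0 T := Icc_subset_Icc_right ht.2
    rw [e, e', ← mul_sub, ← intervalIntegral.integral_sub
      (fk_mul_int hα.1 ht.1 (hgtu.mono hst)) (fk_mul_int hα.1 ht.1 (hgtv.mono hst)), hc₀, mul_assoc]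
    congr 3
    ext s
    rw [hg]; ring
  have hsub₀ : Icc 0 t₀ ⊆ Icc 0 T := Icc_subset_Icc_right ht₀.2
  have hfc : ContinuousOn f (Icc 0 T) := (hutc.sub hvtc).sub continuousOn_const
  have hfd : HasDerivAt f (deriv (u x₀) t₀ - deriv (v x₀) t₀) t₀ :=
    ((hut x₀ hx₀ t₀ ⟨ht0, ht₀.2⟩).sub (hvt x₀ hx₀ t₀ ⟨ht0, ht₀.2⟩)).sub_const _
  obtain ⟨C, hC⟩ := hfd.isBigO_sub.bound
  obtain ⟨η₀, hη₀, hCη⟩ := Metric.eventually_nhds_iff.1 hC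
  obtain ⟨η, hη, hη2⟩ := exists_between (show 0 < min η₀ t₀ from lt_min hη₀ ht0)
  have htime : 0 < g x₀ t₀ := by
    apply fk_time hα.1 hα.2 (t₀ := t₀) (κ := c₀ * fkB (1 - α) α) (C := C) (η := η) (f := f)
      (g := fun t => g x₀ t) ht0
      (mul_pos hc₀pos (fkB_pos (by linarith [hα.2]) hα.1)) hη (lt_min_iff.1 hη2).2
      (hfc.mono hsub₀) (hgt.mono hsub₀)
    · intro s hs
      have := hmax x₀ hx₀ s (hsub₀ hs)
      simp only [hf]; linarith
    · have := hinit x₀ hx₀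
      simp only [hf]; linarith
    · intro s hs
      have h1 := hCη (y := s) (by
        have := (lt_min_iff.1 hη2).1
        rw [Real.dist_eq, abs_lt]; constructor <;> linarith [hs.1, hs.2])
      rw [Real.norm_eq_abs, Real.norm_eq_abs, abs_sub_comm s t₀,
        abs_of_nonneg (by linarith [hs.2] : 0 ≤ t₀ - s)] at h1
      have := neg_abs_le (f s - f t₀)
      linarith
    · intro t ht
      obtain ⟨-, h⟩ := fk_sg (p := 1 - α) (q := α) (by linarith [hα.2]) hα.1 ht.1
        (hgt.mono (Icc_subset_Icc_right (ht.2.trans ht₀.2)))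
      have e1 : 1 - α - 1 = -α := by ring
      have e2 : 1 - α + α - 1 = 0 := by ring
      simp only [e1, e2, Real.rpow_zero, one_mul] at h
      rw [mul_assoc, ← h, ← intervalIntegral.integral_const_mul]
      apply intervalIntegral.integral_congr
      intro s hs
      rw [uIcc_of_le ht.1] at hs
      simp only
      rw [hfint s ⟨hs.1, hs.2.trans (ht.2.trans ht₀.2)⟩]
      ring
  linarith

end FKHelpers

/-- continuous dependence on the initial data for the time-space
fractional pseudo-parabolic equation. -/
theorem pseudo_parabolic_cont_dep
    (α β₁ β₂ ν a b T δ : ℝ)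
    (hα : 0 < α ∧ α < 1) (hβ₁ : 0 < β₁ ∧ β₁ < 1) (hβ₂ : 0 < β₂ ∧ β₂ < 1)
    (hsum : 1 < β₁ + β₂) (hν : 0 < ν) (hab : a < b) (hT : 0 < T) (hδ : 0 < δ)
    (F : ℝ → ℝ → ℝ) (φ φ' ψ₁ ψ₂ : ℝ → ℝ)
    (hF : ContinuousOn (Function.uncurry F) (Set.Icc a b ×ˢ Set.Icc 0 T))
    (hφ : ContinuousOn φ (Set.Icc a b)) (hφ' : ContinuousOn φ' (Set.Icc a b))
    (hψ₁ : ContinuousOn ψ₁ (Set.Icc 0 T)) (hψ₂ : ContinuousOn ψ₂ (Set.Icc 0 T))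
    (u v : ℝ → ℝ → ℝ)
    -- regularity of `u`
    (hu : ContinuousOn (Function.uncurry u) (Set.Icc a b ×ˢ Set.Icc 0 T))
    (hux : ∀ t ∈ Set.Icc (0:ℝ) T, ∀ x ∈ Set.Icc a b,
      HasDerivAt (fun y => u y t) (deriv (fun y => u y t) x) x)
    (hux' : ∀ t ∈ Set.Icc (0:ℝ) T, ContinuousOn (deriv (fun y => u y t)) (Set.Icc a b))
    (hut : ∀ x ∈ Set.Icc a b, ∀ t ∈ Set.Ioc (0:ℝ) T, HasDerivAt (u x) (deriv (u x) t) t)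
    (hut' : ∀ x ∈ Set.Icc a b, ContinuousOn (deriv (u x)) (Set.Ioc 0 T))
    (hDxexu : ∀ t ∈ Set.Icc (0:ℝ) T, ∀ x ∈ Set.Ioo a b,
      HasDerivAt (seqCaputoAux β₁ β₂ a (fun y => u y t))
        (seqCaputo β₁ β₂ a (fun y => u y t) x) x)
    (hwu : ContinuousOn (fun p : ℝ × ℝ => seqCaputo β₁ β₂ a (fun y => u y p.2) p.1)
      (Set.Icc a b ×ˢ Set.Icc 0 T))
    (hrlexu : ∀ x ∈ Set.Icc a b, ∀ t ∈ Set.Ioc (0:ℝ) T,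
      HasDerivAt (rlAux (1 - α) (fun τ => seqCaputo β₁ β₂ a (fun y => u y τ) x))
        (rlDeriv (1 - α) (fun τ => seqCaputo β₁ β₂ a (fun y => u y τ) x) t) t)
    (hrlcu : ContinuousOn
      (fun p : ℝ × ℝ => rlDeriv (1 - α) (fun τ => seqCaputo β₁ β₂ a (fun y => u y τ) p.1) p.2)
      (Set.Icc a b ×ˢ Set.Ioc 0 T))
    -- regularity of `v`
    (hv : ContinuousOn (Function.uncurry v) (Set.Icc a b ×ˢ Set.Icc 0 T))
    (hvx : ∀ t ∈ Set.Icc (0:ℝ) T, ∀ x ∈ Set.Icc a b,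
      HasDerivAt (fun y => v y t) (deriv (fun y => v y t) x) x)
    (hvx' : ∀ t ∈ Set.Icc (0:ℝ) T, ContinuousOn (deriv (fun y => v y t)) (Set.Icc a b))
    (hvt : ∀ x ∈ Set.Icc a b, ∀ t ∈ Set.Ioc (0:ℝ) T, HasDerivAt (v x) (deriv (v x) t) t)
    (hvt' : ∀ x ∈ Set.Icc a b, ContinuousOn (deriv (v x)) (Set.Ioc 0 T))
    (hDxexv : ∀ t ∈ Set.Icc (0:ℝ) T, ∀ x ∈ Set.Ioo a b,
      HasDerivAt (seqCaputoAux β₁ β₂ a (fun y => v y t))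
        (seqCaputo β₁ β₂ a (fun y => v y t) x) x)
    (hwv : ContinuousOn (fun p : ℝ × ℝ => seqCaputo β₁ β₂ a (fun y => v y p.2) p.1)
      (Set.Icc a b ×ˢ Set.Icc 0 T))
    (hrlexv : ∀ x ∈ Set.Icc a b, ∀ t ∈ Set.Ioc (0:ℝ) T,
      HasDerivAt (rlAux (1 - α) (fun τ => seqCaputo β₁ β₂ a (fun y => v y τ) x))
        (rlDeriv (1 - α) (fun τ => seqCaputo β₁ β₂ a (fun y => v y τ) x) t) t)
    (hrlcv : ContinuousOn
      (fun p : ℝ × ℝ => rlDeriv (1 - α) (fun τ => seqCaputo β₁ β₂ a (fun y => v y τ) p.1) p.2)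
      (Set.Icc a b ×ˢ Set.Ioc 0 T))
    -- both satisfy the equation and the same boundary conditions
    (hequ : ∀ x ∈ Set.Ioo a b, ∀ t ∈ Set.Ioc (0:ℝ) T,
      deriv (u x) t
        = ν * rlDeriv (1 - α) (fun τ => seqCaputo β₁ β₂ a (fun y => u y τ) x) t + F x t)
    (heqv : ∀ x ∈ Set.Ioo a b, ∀ t ∈ Set.Ioc (0:ℝ) T,
      deriv (v x) t
        = ν * rlDeriv (1 - α) (fun τ => seqCaputo β₁ β₂ a (fun y => v y τ) x) t + F x t)
    (hbdu : ∀ t ∈ Set.Icc (0:ℝ) T, u a t = ψ₁ t ∧ u b t = ψ₂ t)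
    (hbdv : ∀ t ∈ Set.Icc (0:ℝ) T, v a t = ψ₁ t ∧ v b t = ψ₂ t)
    -- with respective initial data `φ` and `φ'`
    (hinitu : ∀ x ∈ Set.Icc a b, u x 0 = φ x)
    (hinitv : ∀ x ∈ Set.Icc a b, v x 0 = φ' x)
    (hclose : ∀ x ∈ Set.Icc a b, |φ x - φ' x| ≤ δ) :
    ∀ x ∈ Set.Icc a b, ∀ t ∈ Set.Icc (0:ℝ) T, |u x t - v x t| ≤ δ := by
  intro x hx t ht
  rw [abs_le]
  have h1 := fk_one α β₁ β₂ ν a b T δ hα hβ₁ hβ₂ hsum hν hδ F u v hu hux hux' hut hDxexu hwu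
    hrlexu hv hvx hvx' hvt hDxexv hwv hrlexv hequ heqv
    (fun t ht => ⟨by rw [(hbdu t ht).1, (hbdv t ht).1], by rw [(hbdu t ht).2, (hbdv t ht).2]⟩)
    (fun x hx => by
      rw [hinitu x hx, hinitv x hx]; exact (abs_le.1 (hclose x hx)).2) x hx t ht
  have h2 := fk_one α β₁ β₂ ν a b T δ hα hβ₁ hβ₂ hsum hν hδ F v u hv hvx hvx' hvt hDxexv hwv
    hrlexv hu hux hux' hut hDxexu hwu hrlexu heqv hequ
    (fun t ht => ⟨by rw [(hbdu t ht).1, (hbdv t ht).1], by rw [(hbdu t ht).2, (hbdv t ht).2]⟩)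
    (fun x hx => by
      rw [hinitu x hx, hinitv x hx]; linarith [(abs_le.1 (hclose x hx)).1]) x hx t ht
  constructor <;> linarith
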